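/- Let P and Q be positive joint distributions on 𝒳 × 𝒴, let P* be a minimizer of min{ D(P̃‖Q) : P̃ a joint distribution with P̃_X = P_X and P̃_Y = P_Y }, define ȷ(x,y) = log(P*(x,y)/Q(x,y)), and let V = Σ_{x,y} P(x,y)·(ȷ(x,y) − E(P‖Q))² be the variance of ȷ under P; assume V > 0 and that the variance of ȷ under P* is positive. Let 0 < ε < 1. Then there exist a constant C ∈ ℝ and N ∈ ℕ such that for every n ≥ N there is a threshold τₙ ∈ ℝ with P^n({(x,y) : (1/n)Σ_{i=1}^n ȷ(x_i,y_i) ≤ τₙ}) ≤ ε and −log Q^n({(x,y) : (1/n)Σ_{i=1}^n ȷ(x_i,y_i) > τₙ}) ≥ n·E(P‖Q) + √(n·V)·Φ^{-1}(ε) + (1/2)·log n − C. -/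

import Mathlib

open scoped Classical BigOperators

noncomputable section

variable {X Y : Type*} [Fintype X] [Fintype Y]

/-- `P` is a joint distribution on `X × Y`. -/
def IsDist (P : X × Y → ℝ) : Prop :=
  (∀ z, 0 ≤ P z) ∧ ∑ z : X × Y, P z = 1

/-- `P` is a positive joint distribution on `X × Y`. -/
def IsPos (P : X × Y → ℝ) : Prop :=
  (∀ z, 0 < P z) ∧ ∑ z : X × Y, P z = 1

/-- The first marginal of a joint distribution. -/
def margX (P : X × Y → ℝ) (x : X) : ℝ := ∑ y : Y, P (x, y)

/-- The second marginal of a joint distribution. -/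
def margY (P : X × Y → ℝ) (y : Y) : ℝ := ∑ x : X, P (x, y)

/-- Relative entropy `D(P‖Q)` (natural log; `Real.log 0 = 0` realizes `0·log 0 = 0`). -/
def relEnt (P Q : X × Y → ℝ) : ℝ := ∑ z : X × Y, P z * Real.log (P z / Q z)

/-- Projected relative entropy `E(P‖Q)`. -/
def projE (P Q : X × Y → ℝ) : ℝ :=
  sInf { d : ℝ | ∃ P' : X × Y → ℝ,
    IsDist P' ∧ margX P' = margX P ∧ margY P' = margY P ∧ d = relEnt P' Q }

/-- `R ∈ ℰ^{xy}(S)` : `R` has the same correlation coordinates as `S`. -/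
def SameCorr (R S : X × Y → ℝ) : Prop :=
  ∃ a1 : X → ℝ, ∃ a2 : Y → ℝ,
    ∀ x : X, ∀ y : Y, Real.log (R (x, y) / S (x, y)) = a1 x + a2 y

/-- The type (empirical distribution) of a sequence. -/
def empDist {n : ℕ} (x : Fin n → X) (a : X) : ℝ :=
  ((Finset.univ.filter fun i => x i = a).card : ℝ) / n

/-- The joint type of a pair of sequences. -/
def empJoint {n : ℕ} (x : Fin n → X) (y : Fin n → Y) (z : X × Y) : ℝ :=
  ((Finset.univ.filter fun i => x i = z.1 ∧ y i = z.2).card : ℝ) / n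

/-- Probability of a set under the `n`-fold i.i.d. product of `P`. -/
def prodProb (P : X × Y → ℝ) (n : ℕ) (A : Set ((Fin n → X) × (Fin n → Y))) : ℝ :=
  ∑ z : (Fin n → X) × (Fin n → Y),
    if z ∈ A then ∏ i : Fin n, P (z.1 i, z.2 i) else 0

/-- `P` is a joint type with denominator `n` (an element of `𝒫ₙ(𝒳 × 𝒴)`). -/
def IsTypeN (n : ℕ) (P : X × Y → ℝ) : Prop :=
  IsDist P ∧ ∀ z : X × Y, ∃ k : ℕ, P z = (k : ℝ) / n

/-- `Eₙ(P̄‖Q)` : projected relative entropy restricted to joint types. -/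
def En (n : ℕ) (Pbar Q : X × Y → ℝ) : ℝ :=
  sInf { d : ℝ | ∃ Pt : X × Y → ℝ,
    IsTypeN n Pt ∧ margX Pt = margX Pbar ∧ margY Pt = margY Pbar ∧ d = relEnt Pt Q }

/-- Standard normal cumulative distribution function `Φ`. -/
def stdNormalCDF (t : ℝ) : ℝ :=
  ∫ u in Set.Iic t, (Real.sqrt (2 * Real.pi))⁻¹ * Real.exp (-(u ^ 2) / 2)

/-- Inverse of the standard normal CDF, `Φ⁻¹`. -/
def stdNormalCDFInv (e : ℝ) : ℝ := Function.invFun stdNormalCDF e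

section IIDSums

variable {Z : Type*} [Fintype Z]

/-- Expectation of `f (g z₁ + ⋯ + g zₙ)` for i.i.d. `zᵢ` with weights `p`. -/
def iidExp (p g : Z → ℝ) (n : ℕ) (f : ℝ → ℝ) : ℝ :=
  ∑ z : Fin n → Z, (∏ i, p (z i)) * f (∑ i, g (z i))

variable {p g : Z → ℝ}

theorem iidExp_zero (f : ℝ → ℝ) : iidExp p g 0 f = f 0 := by
  simp [iidExp]

theorem iidExp_succ (n : ℕ) (f : ℝ → ℝ) :
    iidExp p g (n + 1) f = ∑ z, p z * iidExp p g n (fun s => f (s + g z)) := by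
  unfold iidExp
  rw [← (Fin.consEquiv (fun _ => Z)).sum_comp, Fintype.sum_prod_type]
  refine Finset.sum_congr rfl fun z _ => ?_
  rw [Finset.mul_sum]
  refine Finset.sum_congr rfl fun w _ => ?_
  simp [Fin.consEquiv, Fin.prod_univ_succ, Fin.sum_univ_succ, mul_assoc, add_comm]

theorem iidExp_mono (hp : ∀ z, 0 ≤ p z) (n : ℕ) {f₁ f₂ : ℝ → ℝ} (h : ∀ s, f₁ s ≤ f₂ s) :
    iidExp p g n f₁ ≤ iidExp p g n f₂ :=
  Finset.sum_le_sum fun _ _ =>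
    mul_le_mul_of_nonneg_left (h _) (Finset.prod_nonneg fun _ _ => hp _)

theorem iidExp_add (n : ℕ) (f₁ f₂ : ℝ → ℝ) :
    iidExp p g n (fun s => f₁ s + f₂ s) = iidExp p g n f₁ + iidExp p g n f₂ := by
  simp only [iidExp, mul_add, Finset.sum_add_distrib]

theorem iidExp_sub (n : ℕ) (f₁ f₂ : ℝ → ℝ) :
    iidExp p g n (fun s => f₁ s - f₂ s) = iidExp p g n f₁ - iidExp p g n f₂ := by
  simp only [iidExp, mul_sub, Finset.sum_sub_distrib]

theorem iidExp_const_mul (n : ℕ) (c : ℝ) (f : ℝ → ℝ) :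
    iidExp p g n (fun s => c * f s) = c * iidExp p g n f := by
  simp only [iidExp, Finset.mul_sum]
  exact Finset.sum_congr rfl fun _ _ => by ring

theorem iidExp_const (hp : ∑ z, p z = 1) (n : ℕ) (c : ℝ) :
    iidExp p g n (fun _ => c) = c := by
  induction n with
  | zero => simp [iidExp_zero]
  | succ n ih => rw [iidExp_succ]; simp only [ih]; rw [← Finset.sum_mul, hp, one_mul]

/-- Exchangeability: each summand contributes equally to `𝔼[S f(S)]`. -/
theorem iidExp_id_mul (n : ℕ) (f : ℝ → ℝ) :
    iidExp p g (n + 1) (fun s => s * f s) =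
      (n + 1) * ∑ z, p z * g z * iidExp p g n (fun s => f (s + g z)) := by
  induction n generalizing f with
  | zero => simp [iidExp_succ, iidExp_zero, mul_assoc]
  | succ n ih =>
    rw [iidExp_succ]
    have key : ∀ z, iidExp p g (n + 1) (fun s => (s + g z) * f (s + g z)) =
        (n + 1) * ∑ w, p w * g w * iidExp p g n (fun s => f (s + g w + g z)) +
          g z * iidExp p g (n + 1) (fun s => f (s + g z)) := fun z => by
      rw [← ih (fun s => f (s + g z)), ← iidExp_const_mul, ← iidExp_add]
      simp only [add_mul]
    have swap : ∑ z, p z * ((n + 1) * ∑ w, p w * g w *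
          iidExp p g n (fun s => f (s + g w + g z))) =
        (n + 1) * ∑ w, p w * g w * iidExp p g (n + 1) (fun s => f (s + g w)) := by
      simp only [iidExp_succ n, Finset.mul_sum]
      rw [Finset.sum_comm]
      refine Finset.sum_congr rfl fun w _ => Finset.sum_congr rfl fun z _ => ?_
      simp only [add_right_comm _ (g w) (g z)]
      ring
    simp only [key, mul_add, Finset.sum_add_distrib, swap]
    have last : ∑ z, p z * (g z * iidExp p g (n + 1) (fun s => f (s + g z))) =
        ∑ z, p z * g z * iidExp p g (n + 1) (fun s => f (s + g z)) :=
      Finset.sum_congr rfl fun _ _ => by ring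
    rw [last]
    push_cast
    ring

/-- Stein form of `𝔼[S f(S)]` for centred summands. -/
theorem iidExp_id_mul_of_centered (hg : ∑ z, p z * g z = 0) (n : ℕ) (f : ℝ → ℝ) :
    iidExp p g (n + 1) (fun s => s * f s) =
      (n + 1) * ∑ z, p z * iidExp p g n (fun s => g z * (f (s + g z) - f s)) := by
  have h : ∀ z, p z * iidExp p g n (fun s => g z * (f (s + g z) - f s)) =
      p z * g z * iidExp p g n (fun s => f (s + g z)) - p z * g z * iidExp p g n f := fun z => by
    rw [iidExp_const_mul, iidExp_sub]; ring
  simp only [iidExp_id_mul, h, Finset.sum_sub_distrib, ← Finset.sum_mul, hg, zero_mul, sub_zero]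

theorem iidExp_sq (hp : ∑ z, p z = 1) (hg : ∑ z, p z * g z = 0) (n : ℕ) :
    iidExp p g n (fun s => s ^ 2) = n * ∑ z, p z * g z ^ 2 := by
  cases n with
  | zero => simp [iidExp_zero]
  | succ n =>
    simp only [sq, iidExp_id_mul_of_centered hg, add_sub_cancel_left, iidExp_const hp]
    push_cast
    rfl

theorem iidExp_abs_le (hp0 : ∀ z, 0 ≤ p z) (hp : ∑ z, p z = 1) (hg : ∑ z, p z * g z = 0)
    (n : ℕ) {κ : ℝ} (hκ : 0 < κ) (hn : n * ∑ z, p z * g z ^ 2 ≤ κ ^ 2) :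
    iidExp p g n (fun s => |s|) ≤ κ := by
  calc iidExp p g n (fun s => |s|)
      ≤ iidExp p g n (fun s => (1 / (2 * κ)) * s ^ 2 + κ / 2) := by
        refine iidExp_mono hp0 n fun s => ?_
        have h : (1 / (2 * κ)) * s ^ 2 + κ / 2 - |s| = (1 / (2 * κ)) * (|s| - κ) ^ 2 := by
          rw [sub_sq, sq_abs]; field_simp; ring
        have : 0 ≤ (1 / (2 * κ)) * (|s| - κ) ^ 2 := by positivity
        linarith
    _ = (1 / (2 * κ)) * (n * ∑ z, p z * g z ^ 2) + κ / 2 := by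
        rw [iidExp_add, iidExp_const_mul, iidExp_sq hp hg, iidExp_const hp]
    _ ≤ (1 / (2 * κ)) * κ ^ 2 + κ / 2 := by gcongr
    _ = κ := by field_simp; ring

/-- A bounded test function whose increments dominate `w` bounds `𝔼[w(S)]` at rate `n^{-1/2}`. -/
theorem iidExp_le_of_increment (hp0 : ∀ z, 0 ≤ p z) (hp : ∑ z, p z = 1)
    (hg : ∑ z, p z * g z = 0) {B : ℝ} (hB : ∀ z, |g z| ≤ B)
    (hv : 0 < ∑ z, p z * g z ^ 2) {f w : ℝ → ℝ} {M : ℝ} (hf : ∀ s, |f s| ≤ M)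
    (hw : ∀ s t, |t| ≤ B → t ^ 2 * w s ≤ t * (f (s + t) - f s)) (n : ℕ) :
    iidExp p g n w ≤ M / √((n + 1) * ∑ z, p z * g z ^ 2) := by
  set v := ∑ z, p z * g z ^ 2 with hv_def
  have hm : (0 : ℝ) < (n + 1) * v := by positivity
  have hM : 0 ≤ M := (abs_nonneg _).trans (hf 0)
  rw [le_div_iff₀ (Real.sqrt_pos.2 hm)]
  have lower : (n + 1) * v * iidExp p g n w ≤ iidExp p g (n + 1) (fun s => s * f s) := by
    rw [iidExp_id_mul_of_centered hg, mul_assoc, hv_def, Finset.sum_mul]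
    refine mul_le_mul_of_nonneg_left (Finset.sum_le_sum fun z _ => ?_) (by positivity)
    rw [mul_assoc, ← iidExp_const_mul]
    exact mul_le_mul_of_nonneg_left (iidExp_mono hp0 n fun s => hw s _ (hB z)) (hp0 z)
  have upper : iidExp p g (n + 1) (fun s => s * f s) ≤ M * √((n + 1) * v) := by
    calc iidExp p g (n + 1) (fun s => s * f s) ≤ iidExp p g (n + 1) (fun s => M * |s|) := by
          refine iidExp_mono hp0 _ fun s => (le_abs_self _).trans ?_
          rw [abs_mul, mul_comm M]
          exact mul_le_mul_of_nonneg_left (hf s) (abs_nonneg s)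
      _ = M * iidExp p g (n + 1) (fun s => |s|) := iidExp_const_mul _ _ _
      _ ≤ M * √((n + 1) * v) := by
          gcongr
          refine iidExp_abs_le hp0 hp hg _ (Real.sqrt_pos.2 hm) ?_
          rw [Real.sq_sqrt hm.le]
          push_cast
          rfl
  have h := lower.trans upper
  refine le_of_mul_le_mul_right ?_ (Real.sqrt_pos.2 hm)
  rw [mul_assoc, Real.mul_self_sqrt hm.le]
  linarith

theorem iidExp_indicator_Icc_le (hp0 : ∀ z, 0 ≤ p z) (hp : ∑ z, p z = 1)
    (hg : ∑ z, p z * g z = 0) {B : ℝ} (hB0 : 0 ≤ B) (hB : ∀ z, |g z| ≤ B)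
    (hv : 0 < ∑ z, p z * g z ^ 2) {a b : ℝ} (hab : a ≤ b) (n : ℕ) :
    iidExp p g n (fun s => if a ≤ s ∧ s ≤ b then 1 else 0) ≤
      ((b - a) / 2 + B) / √((n + 1) * ∑ z, p z * g z ^ 2) := by
  refine iidExp_le_of_increment hp0 hp hg hB hv
    (f := fun s => max (a - B) (min (b + B) s) - (a + b) / 2) (fun s => ?_) (fun s t ht => ?_) n
  · have h1 : a - B ≤ max (a - B) (min (b + B) s) := le_max_left _ _
    have h2 : max (a - B) (min (b + B) s) ≤ b + B :=
      max_le (by linarith) (min_le_left _ _)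
    rw [abs_le]; constructor <;> linarith
  · obtain ⟨ht1, ht2⟩ := abs_le.1 ht
    simp only [sub_sub_sub_cancel_right]
    split_ifs with h
    · rw [min_eq_right (by linarith), min_eq_right (by linarith), max_eq_right (by linarith),
        max_eq_right (by linarith)]
      nlinarith
    · have mono : Monotone fun s : ℝ => max (a - B) (min (b + B) s) := fun x y hxy =>
        max_le_max le_rfl (min_le_min le_rfl hxy)
      rw [mul_zero]
      rcases le_total 0 t with h0 | h0
      · exact mul_nonneg h0 (sub_nonneg.2 (mono (by linarith)))
      · exact mul_nonneg_of_nonpos_of_nonpos h0 (sub_nonpos.2 (mono (by linarith)))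

theorem sq_mul_exp_neg_le {B t : ℝ} (ht : |t| ≤ B) :
    t ^ 2 * Real.exp (-B) ≤ t * (1 - Real.exp (-t)) := by
  obtain ⟨ht1, ht2⟩ := abs_le.1 ht
  rcases le_total 0 t with h0 | h0
  · have h1 : t * Real.exp (-t) ≤ 1 - Real.exp (-t) := by
      have h := mul_le_mul_of_nonneg_right (Real.add_one_le_exp t) (Real.exp_pos (-t)).le
      rw [← Real.exp_add, add_neg_cancel, Real.exp_zero] at h
      linarith
    have h2 : t * Real.exp (-B) ≤ t * Real.exp (-t) := by gcongr
    nlinarith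
  · have h1 : Real.exp (-B) ≤ 1 := Real.exp_le_one_iff.2 (by linarith)
    have h2 := Real.add_one_le_exp (-t)
    nlinarith [sq_nonneg t]

theorem iidExp_exp_neg_tail_le (hp0 : ∀ z, 0 ≤ p z) (hp : ∑ z, p z = 1)
    (hg : ∑ z, p z * g z = 0) {B : ℝ} (hB0 : 0 ≤ B) (hB : ∀ z, |g z| ≤ B)
    (hv : 0 < ∑ z, p z * g z ^ 2) (a : ℝ) (n : ℕ) :
    iidExp p g n (fun s => if a < s then Real.exp (-s) else 0) ≤
      Real.exp (2 * B - a) / √((n + 1) * ∑ z, p z * g z ^ 2) := by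
  refine iidExp_le_of_increment hp0 hp hg hB hv
    (f := fun s => Real.exp (2 * B - a) * (1 - Real.exp (-(max 0 (s - a + B)))))
    (fun s => ?_) (fun s t ht => ?_) n
  · have h1 : Real.exp (-(max 0 (s - a + B))) ≤ 1 :=
      Real.exp_le_one_iff.2 (neg_nonpos.2 (le_max_left _ _))
    have h2 := Real.exp_pos (-(max 0 (s - a + B)))
    rw [abs_of_nonneg (mul_nonneg (Real.exp_pos _).le (by linarith))]
    exact mul_le_of_le_one_right (Real.exp_pos _).le (by linarith)
  · obtain ⟨ht1, ht2⟩ := abs_le.1 ht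
    rw [← mul_sub, sub_sub_sub_cancel_left]
    split_ifs with h
    · rw [max_eq_right (by linarith), max_eq_right (by linarith)]
      have e1 : Real.exp (2 * B - a) * Real.exp (-(s - a + B)) = Real.exp (-s) * Real.exp B := by
        rw [← Real.exp_add, ← Real.exp_add]; ring_nf
      have e2 : Real.exp (-(s + t - a + B)) = Real.exp (-(s - a + B)) * Real.exp (-t) := by
        rw [← Real.exp_add]; ring_nf
      have e3 : Real.exp (-B) * Real.exp B = 1 := by rw [← Real.exp_add]; simp
      calc t ^ 2 * Real.exp (-s)
          = (t ^ 2 * Real.exp (-B)) * (Real.exp (-s) * Real.exp B) := by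
            linear_combination (-(t ^ 2) * Real.exp (-s)) * e3
        _ ≤ (t * (1 - Real.exp (-t))) * (Real.exp (-s) * Real.exp B) :=
            mul_le_mul_of_nonneg_right (sq_mul_exp_neg_le ht) (by positivity)
        _ = _ := by rw [← e1, e2]; ring
    · have mono : Antitone fun s : ℝ => Real.exp (-(max 0 (s - a + B))) := fun x y hxy =>
        Real.exp_le_exp.2 (neg_le_neg (max_le_max le_rfl (by linarith)))
      rw [mul_zero, mul_left_comm]
      refine mul_nonneg (Real.exp_pos _).le ?_
      rcases le_total 0 t with h0 | h0
      · exact mul_nonneg h0 (sub_nonneg.2 (mono (by linarith)))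
      · exact mul_nonneg_of_nonpos_of_nonpos h0 (sub_nonpos.2 (mono (by linarith)))

end IIDSums

section StandardNormal

open MeasureTheory

/-- The standard normal density. -/
def stdNormalPDF (x : ℝ) : ℝ := (√(2 * Real.pi))⁻¹ * Real.exp (-(x ^ 2) / 2)

theorem stdNormalPDF_pos (x : ℝ) : 0 < stdNormalPDF x := by
  unfold stdNormalPDF; positivity

theorem stdNormalPDF_neg (x : ℝ) : stdNormalPDF (-x) = stdNormalPDF x := by
  simp [stdNormalPDF]

theorem stdNormalPDF_anti {x y : ℝ} (h : |x| ≤ |y|) : stdNormalPDF y ≤ stdNormalPDF x := by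
  have := sq_le_sq.2 h
  unfold stdNormalPDF
  gcongr

theorem hasDerivAt_stdNormalPDF (x : ℝ) :
    HasDerivAt stdNormalPDF (-x * stdNormalPDF x) x := by
  have h : HasDerivAt (fun y : ℝ => -(y ^ 2) / 2) (-x) x := by
    refine ((hasDerivAt_pow 2 x).neg.div_const 2).congr_deriv ?_
    push_cast; ring
  refine (h.exp.const_mul (√(2 * Real.pi))⁻¹).congr_deriv ?_
  unfold stdNormalPDF; ring

theorem continuous_stdNormalPDF : Continuous stdNormalPDF :=
  continuous_iff_continuousAt.2 fun x => (hasDerivAt_stdNormalPDF x).continuousAt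

theorem stdNormalPDF_eq (x : ℝ) :
    stdNormalPDF x = (√(2 * Real.pi))⁻¹ * Real.exp (-(1 / 2) * x ^ 2) := by
  unfold stdNormalPDF; ring_nf

theorem integrable_stdNormalPDF : Integrable stdNormalPDF := by
  rw [funext stdNormalPDF_eq]
  exact (integrable_exp_neg_mul_sq (by norm_num)).const_mul _

theorem integrable_id_mul_stdNormalPDF : Integrable fun x => -x * stdNormalPDF x := by
  have h := ((integrable_mul_exp_neg_mul_sq (b := 1 / 2) (by norm_num)).const_mul
    (-(√(2 * Real.pi))⁻¹))
  refine h.congr (Filter.Eventually.of_forall fun x => ?_)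
  simp only [stdNormalPDF_eq]; ring

theorem integral_stdNormalPDF : ∫ x, stdNormalPDF x = 1 := by
  rw [funext stdNormalPDF_eq, integral_const_mul, integral_gaussian]
  rw [div_div_eq_mul_div, div_one, mul_comm Real.pi]
  exact inv_mul_cancel₀ (by positivity)

theorem stdNormalPDF_le_one (x : ℝ) : stdNormalPDF x ≤ 1 := by
  have h1 : (√(2 * Real.pi))⁻¹ ≤ 1 := by
    refine inv_le_one_of_one_le₀ (Real.one_le_sqrt.2 ?_)
    linarith [Real.pi_gt_three]
  have h2 : Real.exp (-(x ^ 2) / 2) ≤ 1 := Real.exp_le_one_iff.2 (by nlinarith [sq_nonneg x])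
  exact mul_le_one₀ h1 (Real.exp_pos _).le h2

theorem tendsto_stdNormalPDF_atBot : Filter.Tendsto stdNormalPDF Filter.atBot (nhds 0) := by
  refine tendsto_zero_of_hasDerivAt_of_integrableOn_Iic (a := 0)
    (fun x _ => hasDerivAt_stdNormalPDF x) integrable_id_mul_stdNormalPDF.integrableOn
    integrable_stdNormalPDF.integrableOn

theorem integral_Iic_neg_id_mul_stdNormalPDF (w : ℝ) :
    ∫ x in Set.Iic w, -x * stdNormalPDF x = stdNormalPDF w := by
  rw [integral_Iic_of_hasDerivAt_of_tendsto continuous_stdNormalPDF.continuousWithinAt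
    (fun x _ => hasDerivAt_stdNormalPDF x) integrable_id_mul_stdNormalPDF.integrableOn
    tendsto_stdNormalPDF_atBot, sub_zero]

theorem integrable_mul_stdNormalPDF {k : ℝ → ℝ} (hk : Continuous k) (hk1 : ∀ x, |k x| ≤ 1) :
    Integrable fun x => k x * stdNormalPDF x :=
  integrable_stdNormalPDF.bdd_mul (c := 1) hk.aestronglyMeasurable
    (Filter.Eventually.of_forall hk1)

theorem stdNormalCDF_eq (t : ℝ) : stdNormalCDF t = ∫ x in Set.Iic t, stdNormalPDF x := rfl

theorem stdNormalCDF_le_one (t : ℝ) : stdNormalCDF t ≤ 1 := by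
  rw [stdNormalCDF_eq, ← integral_stdNormalPDF]
  exact setIntegral_le_integral integrable_stdNormalPDF
    (Filter.Eventually.of_forall fun x => (stdNormalPDF_pos x).le)

theorem stdNormalCDF_sub (s t : ℝ) :
    stdNormalCDF t - stdNormalCDF s = ∫ x in s..t, stdNormalPDF x :=
  intervalIntegral.integral_Iic_sub_Iic integrable_stdNormalPDF.integrableOn
    integrable_stdNormalPDF.integrableOn

theorem hasDerivAt_integral_Iic {k : ℝ → ℝ} (hk : Continuous k) (hi : Integrable k) (w : ℝ) :
    HasDerivAt (fun t => ∫ x in Set.Iic t, k x) (k w) w := by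
  have h : (fun t => ∫ x in Set.Iic t, k x) =
      fun t => (∫ x in (0 : ℝ)..t, k x) + ∫ x in Set.Iic (0 : ℝ), k x := by
    funext t
    rw [← intervalIntegral.integral_Iic_sub_Iic hi.integrableOn hi.integrableOn, sub_add_cancel]
  rw [h]
  exact (hk.integral_hasStrictDerivAt 0 w).hasDerivAt.add_const _

theorem hasDerivAt_stdNormalCDF (t : ℝ) : HasDerivAt stdNormalCDF (stdNormalPDF t) t :=
  hasDerivAt_integral_Iic continuous_stdNormalPDF integrable_stdNormalPDF t

theorem continuous_stdNormalCDF : Continuous stdNormalCDF :=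
  continuous_iff_continuousAt.2 fun x => (hasDerivAt_stdNormalCDF x).continuousAt

theorem tendsto_stdNormalCDF_atTop : Filter.Tendsto stdNormalCDF Filter.atTop (nhds 1) := by
  rw [← integral_stdNormalPDF]
  exact (aecover_Iic Filter.tendsto_id).integral_tendsto_of_countably_generated
    integrable_stdNormalPDF

theorem stdNormalCDF_neg (t : ℝ) : stdNormalCDF (-t) = 1 - stdNormalCDF t := by
  have h : stdNormalCDF (-t) = ∫ x in Set.Ioi t, stdNormalPDF x := by
    have := integral_comp_neg_Iic (-t) stdNormalPDF
    simp only [stdNormalPDF_neg, neg_neg] at this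
    rw [stdNormalCDF_eq, this]
  rw [h, ← integral_stdNormalPDF, stdNormalCDF_eq, ← intervalIntegral.integral_Iic_add_Ioi
    integrable_stdNormalPDF.integrableOn integrable_stdNormalPDF.integrableOn (b := t)]
  ring

theorem tendsto_stdNormalCDF_atBot : Filter.Tendsto stdNormalCDF Filter.atBot (nhds 0) := by
  have h := (tendsto_stdNormalCDF_atTop.comp Filter.tendsto_neg_atBot_atTop).const_sub 1
  rw [sub_self] at h
  refine h.congr fun t => ?_
  rw [Function.comp_apply, stdNormalCDF_neg]; ring

theorem stdNormalCDF_stdNormalCDFInv {ε : ℝ} (h0 : 0 < ε) (h1 : ε < 1) :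
    stdNormalCDF (stdNormalCDFInv ε) = ε := by
  refine Function.invFun_eq ?_
  exact mem_range_of_exists_le_of_exists_ge continuous_stdNormalCDF
    ((tendsto_stdNormalCDF_atBot.eventually_le_const h0).exists)
    ((tendsto_stdNormalCDF_atTop.eventually_const_le h1).exists)

/-- Near `t` the distribution function grows at least linearly. -/
theorem stdNormalCDF_sub_le (t : ℝ) {d : ℝ} (h0 : 0 ≤ d) (h1 : d ≤ 1) :
    stdNormalCDF (t - d) ≤ stdNormalCDF t - stdNormalPDF (|t| + 1) * d := by
  have h := stdNormalCDF_sub (t - d) t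
  have h2 : ∫ _ in (t - d)..t, stdNormalPDF (|t| + 1) ≤ ∫ x in (t - d)..t, stdNormalPDF x := by
    refine intervalIntegral.integral_mono_on (by linarith) (by simp)
      (continuous_stdNormalPDF.intervalIntegrable _ _) fun x hx => ?_
    refine stdNormalPDF_anti ?_
    rw [abs_of_pos (by positivity : 0 < |t| + 1), abs_le]
    constructor <;> linarith [hx.1, hx.2, neg_abs_le t, le_abs_self t]
  rw [intervalIntegral.integral_const, sub_sub_cancel, smul_eq_mul] at h2
  linarith

theorem abs_integral_Iic_mul_stdNormalPDF_le {k : ℝ → ℝ} (hk1 : ∀ x, |k x| ≤ 1) (w : ℝ) :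
    |∫ x in Set.Iic w, k x * stdNormalPDF x| ≤ stdNormalCDF w := by
  rw [stdNormalCDF_eq, ← Real.norm_eq_abs]
  refine norm_integral_le_of_norm_le integrable_stdNormalPDF.integrableOn
    (Filter.Eventually.of_forall fun x => ?_)
  rw [Real.norm_eq_abs, abs_mul, abs_of_pos (stdNormalPDF_pos x)]
  exact mul_le_of_le_one_left (stdNormalPDF_pos x).le (hk1 x)

/-- Mills ratio bound. -/
theorem neg_mul_stdNormalCDF_le (w : ℝ) : -w * stdNormalCDF w ≤ stdNormalPDF w := by
  rw [← integral_Iic_neg_id_mul_stdNormalPDF w, stdNormalCDF_eq, ← integral_const_mul]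
  refine setIntegral_mono_on (integrable_stdNormalPDF.const_mul _).integrableOn
    integrable_id_mul_stdNormalPDF.integrableOn measurableSet_Iic fun x hx => ?_
  exact mul_le_mul_of_nonneg_right (neg_le_neg hx) (stdNormalPDF_pos x).le

theorem abs_mul_abs_integral_Iic_le {k : ℝ → ℝ} (hk : Continuous k) (hk1 : ∀ x, |k x| ≤ 1)
    (hk0 : ∫ x, k x * stdNormalPDF x = 0) (w : ℝ) :
    |w| * |∫ x in Set.Iic w, k x * stdNormalPDF x| ≤ stdNormalPDF w := by
  rcases le_total w 0 with h | h
  · rw [abs_of_nonpos h]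
    exact (mul_le_mul_of_nonneg_left (abs_integral_Iic_mul_stdNormalPDF_le hk1 w)
      (neg_nonneg.2 h)).trans (neg_mul_stdNormalCDF_le w)
  · have hi := integrable_mul_stdNormalPDF hk hk1
    have h2 := integral_comp_neg_Iic (-w) (fun x => k x * stdNormalPDF x)
    simp only [stdNormalPDF_neg, neg_neg] at h2
    have h3 := intervalIntegral.integral_Iic_add_Ioi hi.integrableOn hi.integrableOn (b := w)
    rw [hk0, ← h2] at h3
    rw [eq_neg_of_add_eq_zero_left h3, abs_neg, abs_of_nonneg h]
    have h4 := mul_le_mul_of_nonneg_left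
      (abs_integral_Iic_mul_stdNormalPDF_le (fun x => hk1 (-x)) (-w)) h
    have h5 := neg_mul_stdNormalCDF_le (-w)
    rw [neg_neg, stdNormalPDF_neg] at h5
    exact h4.trans h5

/-- Solution of Stein's equation `f'(w) = w f(w) + h(w) - 𝔼[h(N)]`, with uniform bounds. -/
theorem exists_stein_solution {h : ℝ → ℝ} (hc : Continuous h) (h0 : ∀ x, 0 ≤ h x)
    (h1 : ∀ x, h x ≤ 1) :
    ∃ f : ℝ → ℝ,
      (∀ w, HasDerivAt f (w * f w + (h w - ∫ x, h x * stdNormalPDF x)) w) ∧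
      (∀ w, |f w| ≤ (stdNormalPDF 1)⁻¹) ∧ (∀ w, |w * f w| ≤ 1) ∧
      ∀ w, |h w - ∫ x, h x * stdNormalPDF x| ≤ 1 := by
  have hi := integrable_mul_stdNormalPDF hc fun x => by rw [abs_of_nonneg (h0 x)]; exact h1 x
  set N := ∫ x, h x * stdNormalPDF x with hN
  have N0 : 0 ≤ N := integral_nonneg fun x => mul_nonneg (h0 x) (stdNormalPDF_pos x).le
  have N1 : N ≤ 1 := by
    rw [← integral_stdNormalPDF]
    exact integral_mono hi integrable_stdNormalPDF fun x =>
      mul_le_of_le_one_left (stdNormalPDF_pos x).le (h1 x)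
  have hk1 : ∀ x, |h x - N| ≤ 1 := fun x =>
    abs_le.2 ⟨by linarith [h0 x], by linarith [h1 x]⟩
  have hkc : Continuous fun x => h x - N := hc.sub continuous_const
  have hk0 : ∫ x, (h x - N) * stdNormalPDF x = 0 := by
    simp only [sub_mul]
    rw [integral_sub hi (integrable_stdNormalPDF.const_mul N), integral_const_mul,
      integral_stdNormalPDF, mul_one, ← hN, sub_self]
  set F : ℝ → ℝ := fun w => ∫ x in Set.Iic w, (h x - N) * stdNormalPDF x with hF
  have wf : ∀ w, |w * (F w / stdNormalPDF w)| ≤ 1 := fun w => by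
    rw [abs_mul, abs_div, abs_of_pos (stdNormalPDF_pos w), ← mul_div_assoc,
      div_le_one (stdNormalPDF_pos w)]
    exact abs_mul_abs_integral_Iic_le hkc hk1 hk0 w
  refine ⟨fun w => F w / stdNormalPDF w, fun w => ?_, fun w => ?_, wf, hk1⟩
  · have hp := (stdNormalPDF_pos w).ne'
    have hF' : HasDerivAt F ((h w - N) * stdNormalPDF w) w :=
      hasDerivAt_integral_Iic (hkc.mul continuous_stdNormalPDF)
        (integrable_mul_stdNormalPDF hkc hk1) w
    refine (hF'.div (hasDerivAt_stdNormalPDF w) hp).congr_deriv ?_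
    field_simp
    ring
  · rcases le_total |w| 1 with hw | hw
    · rw [abs_div, abs_of_pos (stdNormalPDF_pos w), ← one_div]
      exact div_le_div₀ zero_le_one
        ((abs_integral_Iic_mul_stdNormalPDF_le hk1 w).trans (stdNormalCDF_le_one w))
        (stdNormalPDF_pos 1) (stdNormalPDF_anti (by rwa [abs_one]))
    · have h2 := wf w
      rw [abs_mul] at h2
      calc |F w / stdNormalPDF w| ≤ |w| * |F w / stdNormalPDF w| :=
            le_mul_of_one_le_left (abs_nonneg _) hw
        _ ≤ 1 := h2
        _ ≤ _ := (one_le_inv₀ (stdNormalPDF_pos 1)).2 (stdNormalPDF_le_one 1)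

end StandardNormal

section BerryEsseen

open MeasureTheory

theorem abs_sub_sub_mul_deriv_le {f D : ℝ → ℝ} (hf : ∀ w, HasDerivAt f (D w) w) {η r w : ℝ}
    (hD : ∀ u, |u| ≤ η → |D (w + u) - D w| ≤ r) {u : ℝ} (hu : |u| ≤ η) :
    |f (w + u) - f w - u * D w| ≤ r * |u| := by
  have hη : 0 ≤ η := (abs_nonneg u).trans hu
  obtain ⟨hu1, hu2⟩ := abs_le.1 hu
  have h := Convex.norm_image_sub_le_of_norm_hasDerivWithin_le (𝕜 := ℝ)
    (f := fun x => f x - x * D w) (f' := fun x => D x - 1 * D w) (s := Set.Icc (w - η) (w + η))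
    (x := w) (y := w + u) (C := r)
    (fun x _ => ((hf x).sub ((hasDerivAt_id x).mul_const (D w))).hasDerivWithinAt)
    (fun x hx => by
      have := hD (x - w) (abs_le.2 ⟨by linarith [hx.1], by linarith [hx.2]⟩)
      rwa [add_sub_cancel, ← one_mul (D w)] at this)
    (convex_Icc _ _) ⟨by linarith, by linarith⟩ ⟨by linarith, by linarith⟩
  rw [Real.norm_eq_abs, Real.norm_eq_abs, add_sub_cancel_left] at h
  convert h using 2
  ring

/-- Modulus of continuity of the derivative of a Stein solution. -/
theorem abs_stein_deriv_sub_le {f h : ℝ → ℝ} {N A : ℝ}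
    (hf : ∀ w, HasDerivAt f (w * f w + (h w - N)) w) (hA : ∀ w, |f w| ≤ A)
    (hwf : ∀ w, |w * f w| ≤ 1) (hN : ∀ w, |h w - N| ≤ 1) {η : ℝ} {J : ℝ → ℝ}
    (hJ : ∀ w u, |u| ≤ η → |h (w + u) - h w| ≤ J w) (w u : ℝ) (hu : |u| ≤ η) :
    |(w + u) * f (w + u) + (h (w + u) - N) - (w * f w + (h w - N))| ≤
      η * (A + 2 * |w|) + J w := by
  have hη : 0 ≤ η := (abs_nonneg u).trans hu
  have hlip : |f (w + u) - f w| ≤ 2 * |u| := by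
    have h := Convex.norm_image_sub_le_of_norm_hasDerivWithin_le (𝕜 := ℝ) (f := f)
      (s := Set.univ) (x := w) (y := w + u) (C := 2) (fun x _ => (hf x).hasDerivWithinAt)
      (fun x _ => (abs_add_le _ _).trans (by linarith [hwf x, hN x])) convex_univ trivial trivial
    rwa [Real.norm_eq_abs, Real.norm_eq_abs, add_sub_cancel_left] at h
  have e : (w + u) * f (w + u) + (h (w + u) - N) - (w * f w + (h w - N)) =
      u * f (w + u) + w * (f (w + u) - f w) + (h (w + u) - h w) := by ring
  rw [e]
  have b1 : |u * f (w + u)| ≤ η * A := by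
    rw [abs_mul]; exact mul_le_mul hu (hA _) (abs_nonneg _) hη
  have b2 : |w * (f (w + u) - f w)| ≤ |w| * (2 * η) := by
    rw [abs_mul]
    exact mul_le_mul_of_nonneg_left (hlip.trans (by linarith)) (abs_nonneg w)
  calc _ ≤ |u * f (w + u)| + |w * (f (w + u) - f w)| + |h (w + u) - h w| := abs_add_three _ _ _
    _ ≤ η * A + |w| * (2 * η) + J w := add_le_add (add_le_add b1 b2) (hJ w u hu)
    _ = _ := by ring

/-- Continuous cutoff equal to `1` below `z` and `0` above `z + δ`. -/
def rampCutoff (z δ x : ℝ) : ℝ := max 0 (min 1 ((z + δ - x) / δ))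

theorem continuous_rampCutoff (z δ : ℝ) : Continuous (rampCutoff z δ) := by
  unfold rampCutoff; fun_prop

theorem rampCutoff_nonneg (z δ x : ℝ) : 0 ≤ rampCutoff z δ x := le_max_left _ _

theorem rampCutoff_le_one (z δ x : ℝ) : rampCutoff z δ x ≤ 1 :=
  max_le zero_le_one (min_le_left _ _)

theorem rampCutoff_eq_one {z δ x : ℝ} (hδ : 0 < δ) (h : x ≤ z) : rampCutoff z δ x = 1 := by
  have : 1 ≤ (z + δ - x) / δ := (one_le_div hδ).2 (by linarith)
  rw [rampCutoff, min_eq_left this, max_eq_right zero_le_one]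

theorem rampCutoff_eq_zero {z δ x : ℝ} (hδ : 0 < δ) (h : z + δ ≤ x) : rampCutoff z δ x = 0 :=
  max_eq_left ((min_le_right _ _).trans (div_nonpos_of_nonpos_of_nonneg (by linarith) hδ.le))

theorem abs_rampCutoff_sub_le {z δ η : ℝ} (hδ : 0 < δ) (w u : ℝ) (hu : |u| ≤ η) :
    |rampCutoff z δ (w + u) - rampCutoff z δ w| ≤
      if z - η ≤ w ∧ w ≤ z + δ + η then 1 else 0 := by
  obtain ⟨hu1, hu2⟩ := abs_le.1 hu
  split_ifs with h
  · rw [abs_le]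
    constructor <;> linarith [rampCutoff_nonneg z δ w, rampCutoff_nonneg z δ (w + u),
      rampCutoff_le_one z δ w, rampCutoff_le_one z δ (w + u)]
  · rw [not_and_or, not_le, not_le] at h
    rcases h with h | h
    · rw [rampCutoff_eq_one hδ (by linarith), rampCutoff_eq_one hδ (by linarith)]; simp
    · rw [rampCutoff_eq_zero hδ (by linarith), rampCutoff_eq_zero hδ (by linarith)]; simp

theorem integral_rampCutoff_le {z δ : ℝ} (hδ : 0 < δ) :
    ∫ x, rampCutoff z δ x * stdNormalPDF x ≤ stdNormalCDF (z + δ) := by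
  rw [stdNormalCDF_eq, ← integral_indicator measurableSet_Iic]
  refine integral_mono (integrable_mul_stdNormalPDF (continuous_rampCutoff z δ) fun x => ?_)
    (integrable_stdNormalPDF.indicator measurableSet_Iic) fun x => ?_
  · rw [abs_of_nonneg (rampCutoff_nonneg z δ x)]; exact rampCutoff_le_one z δ x
  · by_cases hx : x ≤ z + δ
    · rw [Set.indicator_of_mem (Set.mem_Iic.2 hx)]
      exact mul_le_of_le_one_left (stdNormalPDF_pos x).le (rampCutoff_le_one z δ x)
    · rw [Set.indicator_of_notMem (by simpa using hx)]
      simp only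
      rw [rampCutoff_eq_zero hδ (not_le.1 hx).le, zero_mul]

variable {Z : Type*} [Fintype Z] {p g : Z → ℝ}

/-- Stein's method bound for the normal approximation of a normalized i.i.d. sum. -/
theorem iidExp_sub_integral_le (hp0 : ∀ z, 0 ≤ p z) (hp : ∑ z, p z = 1)
    (hg : ∑ z, p z * g z = 0) {B : ℝ} (hB : ∀ z, |g z| ≤ B) {n : ℕ} {c : ℝ} (hc : 0 < c)
    (hcv : c ^ 2 * ((n + 1) * ∑ z, p z * g z ^ 2) = 1) {h : ℝ → ℝ} (hcont : Continuous h)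
    (h0 : ∀ x, 0 ≤ h x) (h1 : ∀ x, h x ≤ 1) {J : ℝ → ℝ}
    (hJ : ∀ w u, |u| ≤ c * B → |h (w + u) - h w| ≤ J w) :
    iidExp p g (n + 1) (fun s => h (c * s)) - ∫ x, h x * stdNormalPDF x ≤
      2 * (c * B * ((stdNormalPDF 1)⁻¹ + 2) + iidExp p g n (fun s => J (c * s))) := by
  obtain ⟨f, hf, hA, hwf, hN⟩ := exists_stein_solution hcont h0 h1
  set N := ∫ x, h x * stdNormalPDF x
  set A := (stdNormalPDF 1)⁻¹
  set v := ∑ z, p z * g z ^ 2 with hv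
  let D : ℝ → ℝ := fun w => w * f w + (h w - N)
  let ρ : ℝ → ℝ := fun w => c * B * (A + 2 * |w|) + J w
  have hcB : ∀ z, |c * g z| ≤ c * B := fun z => by
    rw [abs_mul, abs_of_pos hc]; exact mul_le_mul_of_nonneg_left (hB z) hc.le
  have hD : ∀ w u, |u| ≤ c * B → |D (w + u) - D w| ≤ ρ w :=
    abs_stein_deriv_sub_le hf hA hwf hN hJ
  have lower : iidExp p g n (fun s => D (c * s)) - iidExp p g n (fun s => ρ (c * s)) ≤
      iidExp p g (n + 1) (fun s => s * (c * f (c * s))) := by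
    rw [iidExp_id_mul_of_centered hg]
    calc iidExp p g n (fun s => D (c * s)) - iidExp p g n (fun s => ρ (c * s))
        = (c ^ 2 * ((n + 1) * v)) * iidExp p g n (fun s => D (c * s) - ρ (c * s)) := by
          rw [hcv, one_mul, iidExp_sub]
      _ = (n + 1) * ∑ z, p z * iidExp p g n
            (fun s => (c * g z) ^ 2 * (D (c * s) - ρ (c * s))) := by
          simp only [iidExp_const_mul, hv, Finset.mul_sum, Finset.sum_mul]
          exact Finset.sum_congr rfl fun _ _ => by ring
      _ ≤ _ := by
          refine mul_le_mul_of_nonneg_left (Finset.sum_le_sum fun z _ =>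
            mul_le_mul_of_nonneg_left (iidExp_mono hp0 n fun s => ?_) (hp0 z)) (by positivity)
          have key := abs_sub_sub_mul_deriv_le hf (hD (c * s)) (hcB z)
          have key2 := mul_le_mul_of_nonneg_left key (abs_nonneg (c * g z))
          rw [← abs_mul, mul_left_comm, abs_mul_abs_self] at key2
          have key3 := (abs_le.1 key2).1
          rw [mul_add c s]
          simp only [D] at key3 ⊢
          nlinarith [key3]
  have upper : iidExp p g (n + 1) (fun s => D (c * s)) ≤
      iidExp p g n (fun s => D (c * s)) + iidExp p g n (fun s => ρ (c * s)) := by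
    rw [iidExp_succ, ← iidExp_add, ← one_mul (iidExp p g n _), ← hp, Finset.sum_mul]
    refine Finset.sum_le_sum fun z _ =>
      mul_le_mul_of_nonneg_left (iidExp_mono hp0 n fun s => ?_) (hp0 z)
    rw [mul_add]
    linarith [(abs_le.1 (hD (c * s) _ (hcB z))).2]
  have split : iidExp p g (n + 1) (fun s => D (c * s)) =
      iidExp p g (n + 1) (fun s => s * (c * f (c * s))) +
        (iidExp p g (n + 1) (fun s => h (c * s)) - N) := by
    have e : iidExp p g (n + 1) (fun s => h (c * s)) - N =
        iidExp p g (n + 1) (fun s => h (c * s) - N) := by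
      rw [iidExp_sub, iidExp_const hp]
    rw [e, ← iidExp_add]
    congr 1
    funext s
    simp only [D]
    ring
  have habs : iidExp p g n (fun s => |s|) ≤ 1 / c := by
    refine iidExp_abs_le hp0 hp hg n (by positivity) ?_
    rw [div_pow, one_pow, le_div_iff₀ (by positivity)]
    have : 0 ≤ v := Finset.sum_nonneg fun z _ => mul_nonneg (hp0 z) (sq_nonneg _)
    nlinarith [mul_nonneg (sq_nonneg c) this]
  have hρ : iidExp p g n (fun s => ρ (c * s)) ≤
      c * B * (A + 2) + iidExp p g n (fun s => J (c * s)) := by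
    have hB0 : 0 ≤ B := by
      rcases isEmpty_or_nonempty Z with hZ | ⟨⟨z⟩⟩
      · simp at hp
      · exact (abs_nonneg _).trans (hB z)
    have e : iidExp p g n (fun s => ρ (c * s)) =
        c * B * (A + 2 * (c * iidExp p g n (fun s => |s|))) +
          iidExp p g n (fun s => J (c * s)) := by
      rw [← iidExp_const (g := g) hp n A, ← iidExp_const_mul, ← iidExp_const_mul, ← iidExp_add,
        ← iidExp_const_mul, ← iidExp_add]
      simp only [ρ, abs_mul, abs_of_pos hc]
    have : c * iidExp p g n (fun s => |s|) ≤ 1 := by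
      have := mul_le_mul_of_nonneg_left habs hc.le
      rwa [mul_one_div_cancel hc.ne'] at this
    rw [e]
    gcongr
    linarith
  linarith

/-- One-sided Berry–Esseen bound for bounded i.i.d. sums. -/
theorem iidExp_indicator_Iic_le (hp0 : ∀ z, 0 ≤ p z) (hp : ∑ z, p z = 1)
    (hg : ∑ z, p z * g z = 0) {B : ℝ} (hB0 : 0 ≤ B) (hB : ∀ z, |g z| ≤ B)
    (hv : 0 < ∑ z, p z * g z ^ 2) {n : ℕ} {c : ℝ}
    (hc : c = (√((n + 1) * ∑ z, p z * g z ^ 2))⁻¹) (t : ℝ) :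
    iidExp p g (n + 1) (fun s => if c * s ≤ t then 1 else 0) ≤
      stdNormalCDF (t + c) + 2 * (B * ((stdNormalPDF 1)⁻¹ + 2) + (1 / 2 + 2 * B)) * c := by
  set v := ∑ z, p z * g z ^ 2 with hv_def
  have hm : (0 : ℝ) < (n + 1) * v := by positivity
  have hc0 : 0 < c := hc ▸ inv_pos.2 (Real.sqrt_pos.2 hm)
  have hcv : c ^ 2 * ((n + 1) * v) = 1 := by
    rw [hc, inv_pow, Real.sq_sqrt hm.le, inv_mul_cancel₀ hm.ne']
  have stein := iidExp_sub_integral_le hp0 hp hg hB hc0 hcv (continuous_rampCutoff t c)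
    (rampCutoff_nonneg t c) (rampCutoff_le_one t c)
    (abs_rampCutoff_sub_le (z := t) (η := c * B) hc0)
  have dom : iidExp p g (n + 1) (fun s => if c * s ≤ t then 1 else 0) ≤
      iidExp p g (n + 1) (fun s => rampCutoff t c (c * s)) := by
    refine iidExp_mono hp0 _ fun s => ?_
    split_ifs with h
    · rw [rampCutoff_eq_one hc0 h]
    · exact rampCutoff_nonneg _ _ _
  have conc : iidExp p g n
      (fun s => if t - c * B ≤ c * s ∧ c * s ≤ t + c + c * B then 1 else 0) ≤
      (1 / 2 + 2 * B) * c := by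
    have h := iidExp_indicator_Icc_le hp0 hp hg hB0 hB hv
      (a := t / c - B) (b := t / c + 1 + B) (by linarith) n
    rw [← hv_def, div_eq_mul_inv _ (√_), ← hc] at h
    convert h using 2
    · funext s
      congr 1
      have e1 : t - c * B = c * (t / c - B) := by field_simp
      have e2 : t + c + c * B = c * (t / c + 1 + B) := by field_simp
      rw [e1, e2, mul_le_mul_iff_right₀ hc0, mul_le_mul_iff_right₀ hc0]
    · ring
  linarith [integral_rampCutoff_le (z := t) hc0]

end BerryEsseen

section MinimumRelativeEntropy

theorem sub_le_mul_log_div {x q : ℝ} (hx : 0 ≤ x) (hq : 0 < q) :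
    x - q ≤ x * Real.log (x / q) := by
  rcases hx.eq_or_lt with rfl | hx
  · simpa using hq.le
  · have h := mul_le_mul_of_nonneg_left (Real.one_sub_inv_le_log_of_pos (div_pos hx hq)) hx.le
    rwa [inv_div, mul_sub, mul_one, mul_div_cancel₀ q hx.ne'] at h

theorem mul_log_div_eq {x q : ℝ} (hq : 0 < q) :
    x * Real.log (x / q) = x * Real.log x - x * Real.log q := by
  rcases eq_or_ne x 0 with rfl | hx
  · simp
  · rw [Real.log_div hx hq.ne', mul_sub]

theorem mul_log_div_convex_le {a b q l : ℝ} (ha : 0 ≤ a) (hb : 0 ≤ b) (hq : 0 < q)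
    (hl0 : 0 ≤ l) (hl1 : l ≤ 1) :
    ((1 - l) * a + l * b) * Real.log (((1 - l) * a + l * b) / q) ≤
      (1 - l) * (a * Real.log (a / q)) + l * (b * Real.log (b / q)) := by
  have h := Real.convexOn_mul_log.2 (Set.mem_Ici.2 ha) (Set.mem_Ici.2 hb)
    (sub_nonneg.2 hl1) hl0 (by ring)
  simp only [smul_eq_mul] at h
  rw [mul_log_div_eq hq, mul_log_div_eq hq, mul_log_div_eq hq]
  linarith

theorem IsPos.isDist {P : X × Y → ℝ} (hP : IsPos P) : IsDist P :=
  ⟨fun z => (hP.1 z).le, hP.2⟩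

theorem projE_le_relEnt {P Q R : X × Y → ℝ} (hQ : IsPos Q) (hR : IsDist R)
    (hX : margX R = margX P) (hY : margY R = margY P) : projE P Q ≤ relEnt R Q := by
  refine csInf_le ⟨0, ?_⟩ ⟨R, hR, hX, hY, rfl⟩
  rintro _ ⟨S, hS, -, -, rfl⟩
  calc (0 : ℝ) = ∑ z, (S z - Q z) := by rw [Finset.sum_sub_distrib, hS.2, hQ.2, sub_self]
    _ ≤ relEnt S Q := Finset.sum_le_sum fun z _ => sub_le_mul_log_div (hS.1 z) (hQ.1 z)

variable {P Q Ps : X × Y → ℝ}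

/-- The minimizer has no larger relative entropy than points on the line joining it to `P`. -/
theorem relEnt_le_relEnt_line (hP : IsDist P) (hQ : IsPos Q) (hPs : IsDist Ps)
    (hPsX : margX Ps = margX P) (hPsY : margY Ps = margY P) (hmin : relEnt Ps Q = projE P Q)
    {l : ℝ} (hl : ∀ z, 0 ≤ (1 - l) * Ps z + l * P z) :
    relEnt Ps Q ≤ relEnt (fun z => (1 - l) * Ps z + l * P z) Q := by
  rw [hmin]
  refine projE_le_relEnt hQ ⟨hl, ?_⟩ (funext fun x => ?_) (funext fun y => ?_)
  · rw [Finset.sum_add_distrib, ← Finset.mul_sum, ← Finset.mul_sum, hP.2, hPs.2]; ring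
  · have h := congrFun hPsX x
    unfold margX at h ⊢
    rw [Finset.sum_add_distrib, ← Finset.mul_sum, ← Finset.mul_sum, h]; ring
  · have h := congrFun hPsY y
    unfold margY at h ⊢
    rw [Finset.sum_add_distrib, ← Finset.mul_sum, ← Finset.mul_sum, h]; ring

theorem pos_of_relEnt_eq_projE (hP : IsPos P) (hQ : IsPos Q) (hPs : IsDist Ps)
    (hPsX : margX Ps = margX P) (hPsY : margY Ps = margY P) (hmin : relEnt Ps Q = projE P Q)
    (z₀ : X × Y) : 0 < Ps z₀ := by
  refine (hPs.1 z₀).lt_of_ne' fun hz => ?_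
  have hPz := hP.1 z₀
  have key : ∀ l : ℝ, 0 < l → l ≤ 1 → relEnt Ps Q ≤ relEnt P Q + P z₀ * Real.log l := by
    intro l hl0 hl1
    have h1 := relEnt_le_relEnt_line hP.isDist hQ hPs hPsX hPsY hmin (l := l) fun z =>
      add_nonneg (mul_nonneg (sub_nonneg.2 hl1) (hPs.1 z)) (mul_nonneg hl0.le (hP.1 z).le)
    have h2 : relEnt (fun z => (1 - l) * Ps z + l * P z) Q ≤
        (1 - l) * relEnt Ps Q + l * relEnt P Q + l * (P z₀ * Real.log l) := by
      have e : l * (P z₀ * Real.log l) =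
          ∑ z, if z = z₀ then l * (P z₀ * Real.log l) else 0 := by simp
      unfold relEnt
      rw [e, Finset.mul_sum, Finset.mul_sum, ← Finset.sum_add_distrib, ← Finset.sum_add_distrib]
      refine Finset.sum_le_sum fun z _ => ?_
      by_cases hzz : z = z₀
      · subst hzz
        simp only [if_pos, hz, mul_zero, zero_add, zero_mul]
        rw [mul_div_assoc,
          Real.log_mul hl0.ne' (div_pos hPz (hQ.1 z)).ne']
        exact le_of_eq (by ring)
      · rw [if_neg hzz, add_zero]
        exact mul_log_div_convex_le (hPs.1 z) (hP.1 z).le (hQ.1 z) hl0.le hl1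
    refine le_of_mul_le_mul_left ?_ hl0
    linarith
  have hk : 0 ≤ (|relEnt P Q - relEnt Ps Q| + 1) / P z₀ := by positivity
  have h := key (Real.exp (-((|relEnt P Q - relEnt Ps Q| + 1) / P z₀))) (Real.exp_pos _)
    (Real.exp_le_one_iff.2 (neg_nonpos.2 hk))
  rw [Real.log_exp, mul_neg, mul_div_cancel₀ _ hPz.ne'] at h
  linarith [le_abs_self (relEnt P Q - relEnt Ps Q)]

/-- First-order optimality: the log-likelihood ratio has the same mean under `P` and `Ps`. -/
theorem sum_mul_log_div_eq_projE (hP : IsPos P) (hQ : IsPos Q) (hPs : IsDist Ps)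
    (hPsX : margX Ps = margX P) (hPsY : margY Ps = margY P) (hmin : relEnt Ps Q = projE P Q) :
    ∑ z, P z * Real.log (Ps z / Q z) = projE P Q := by
  have hpos := pos_of_relEnt_eq_projE hP hQ hPs hPsX hPsY hmin
  have hd : ∀ z, HasDerivAt (fun l : ℝ => (1 - l) * Ps z + l * P z) (P z - Ps z) 0 := fun z =>
    ((((hasDerivAt_id (0 : ℝ)).const_sub 1).mul_const (Ps z)).add
      ((hasDerivAt_id (0 : ℝ)).mul_const (P z))).congr_deriv (by ring)
  have hderiv : HasDerivAt (fun l : ℝ => relEnt (fun z => (1 - l) * Ps z + l * P z) Q)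
      (∑ z, ((P z - Ps z) * Real.log (Ps z / Q z) + (P z - Ps z))) 0 := by
    unfold relEnt
    refine HasDerivAt.fun_sum fun z _ => ?_
    have h0 : (1 - (0 : ℝ)) * Ps z + 0 * P z = Ps z := by ring
    have hq := (hQ.1 z).ne'
    have hp := (hpos z).ne'
    have hlog := ((hd z).div_const (Q z)).log (by rw [h0]; exact div_ne_zero hp hq)
    refine ((hd z).mul hlog).congr_deriv ?_
    rw [h0]
    field_simp
  have hloc : IsLocalMin (fun l : ℝ => relEnt (fun z => (1 - l) * Ps z + l * P z) Q) 0 := by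
    have hev : ∀ᶠ l : ℝ in nhds 0, ∀ z, 0 < (1 - l) * Ps z + l * P z :=
      Filter.eventually_all.2 fun z =>
        (hd z).continuousAt.eventually_const_lt (by simpa using hpos z)
    filter_upwards [hev] with l hl
    have h := relEnt_le_relEnt_line hP.isDist hQ hPs hPsX hPsY hmin fun z => (hl z).le
    simpa using h
  have h := hloc.hasDerivAt_eq_zero hderiv
  simp only [sub_mul, Finset.sum_add_distrib, Finset.sum_sub_distrib, hP.2, hPs.2] at h
  rw [← hmin, relEnt]
  linarith

end MinimumRelativeEntropy

section ProductProbability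

theorem prodProb_setOf_sum (P j : X × Y → ℝ) (e : ℝ) (n : ℕ) (φ : ℝ → Prop) :
    prodProb P n {z | φ (∑ i, j (z.1 i, z.2 i))} =
      iidExp P (fun z => j z - e) n (fun s => if φ (s + n * e) then 1 else 0) := by
  unfold prodProb iidExp
  rw [← (Equiv.arrowProdEquivProdArrow (Fin n) (fun _ => X) (fun _ => Y)).sum_comp]
  refine Finset.sum_congr rfl fun z _ => ?_
  simp [Equiv.arrowProdEquivProdArrow, Finset.sum_sub_distrib]

theorem prodProb_pos_of_ne_zero {P Q : X × Y → ℝ} (hQ : ∀ z, 0 < Q z) {n : ℕ}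
    {A : Set ((Fin n → X) × (Fin n → Y))} (h : prodProb P n A ≠ 0) : 0 < prodProb Q n A := by
  obtain ⟨z, -, hz⟩ := Finset.exists_ne_zero_of_sum_ne_zero h
  have hzA : z ∈ A := by
    by_contra hzA
    exact hz (if_neg hzA)
  refine Finset.sum_pos' (fun w _ => ?_) ⟨z, Finset.mem_univ _, ?_⟩
  · split_ifs
    · exact Finset.prod_nonneg fun _ _ => (hQ _).le
    · exact le_rfl
  · rw [if_pos hzA]
    exact Finset.prod_pos fun _ _ => hQ _

/-- Exponential change of measure. -/
theorem iidExp_exp_tilt {Z : Type*} [Fintype Z] {p q g : Z → ℝ} {e : ℝ}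
    (h : ∀ z, q z = p z * Real.exp (-(g z + e))) (n : ℕ) (f : ℝ → ℝ) :
    iidExp q g n f = iidExp p g n (fun s => Real.exp (-(s + n * e)) * f s) := by
  unfold iidExp
  refine Finset.sum_congr rfl fun z _ => ?_
  simp only [h, Finset.prod_mul_distrib, ← Real.exp_sum, Finset.sum_neg_distrib,
    Finset.sum_add_distrib, Finset.sum_const, Finset.card_univ, Fintype.card_fin, nsmul_eq_mul]
  ring

end ProductProbability

/-- second-order achievability of the Neyman-Pearson-like test. -/
theorem second_order_achievability
    [Nonempty X] [Nonempty Y]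
    (P Q Ps : X × Y → ℝ) (hP : IsPos P) (hQ : IsPos Q)
    (hPs : IsDist Ps) (hPsX : margX Ps = margX P) (hPsY : margY Ps = margY P)
    (hmin : relEnt Ps Q = projE P Q)
    (j : X × Y → ℝ) (hj : ∀ z : X × Y, j z = Real.log (Ps z / Q z))
    (V : ℝ) (hV : V = ∑ z : X × Y, P z * (j z - projE P Q) ^ 2) (hVpos : 0 < V)
    (hVstar : 0 < ∑ z : X × Y, Ps z * (j z - relEnt Ps Q) ^ 2)
    (ε : ℝ) (hε0 : 0 < ε) (hε1 : ε < 1) :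
    ∃ C : ℝ, ∃ N : ℕ, ∀ n : ℕ, N ≤ n → ∃ τ : ℝ,
      prodProb P n
          {z : (Fin n → X) × (Fin n → Y) |
            (1 / (n : ℝ)) * ∑ i : Fin n, j (z.1 i, z.2 i) ≤ τ} ≤ ε ∧
      -(Real.log (prodProb Q n
          {z : (Fin n → X) × (Fin n → Y) |
            (1 / (n : ℝ)) * ∑ i : Fin n, j (z.1 i, z.2 i) > τ}))
        ≥ (n : ℝ) * projE P Q + Real.sqrt ((n : ℝ) * V) * stdNormalCDFInv ε
            + (1 / 2) * Real.log (n : ℝ) - C := by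
  set E := projE P Q
  set t := stdNormalCDFInv ε
  set g : X × Y → ℝ := fun z => j z - E with hg_def
  have hPs0 := pos_of_relEnt_eq_projE hP hQ hPs hPsX hPsY hmin
  have hgP : ∑ z, P z * g z = 0 := by
    simp only [hg_def, mul_sub, Finset.sum_sub_distrib, ← Finset.sum_mul, hP.2, one_mul, hj]
    rw [sum_mul_log_div_eq_projE hP hQ hPs hPsX hPsY hmin, sub_self]
  have hgPs : ∑ z, Ps z * g z = 0 := by
    simp only [hg_def, mul_sub, Finset.sum_sub_distrib, ← Finset.sum_mul, hPs.2, one_mul, hj]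
    rw [← hmin, relEnt, sub_self]
  set v := ∑ z, Ps z * g z ^ 2
  have hv : 0 < v := by rwa [hmin] at hVstar
  set B := ∑ z, |g z|
  have hB0 : 0 ≤ B := Finset.sum_nonneg fun z _ => abs_nonneg _
  have hB : ∀ z, |g z| ≤ B := fun z =>
    Finset.single_le_sum (f := fun z => |g z|) (fun z _ => abs_nonneg _) (Finset.mem_univ z)
  set K := 2 * (B * ((stdNormalPDF 1)⁻¹ + 2) + (1 / 2 + 2 * B)) with hK
  have hK0 : 0 ≤ K := by have := stdNormalPDF_pos 1; positivity
  set r := stdNormalPDF (|t| + 1) with hr_def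
  have hr : 0 < r := stdNormalPDF_pos _
  obtain ⟨N, hN⟩ := exists_nat_ge ((K / r) ^ 2 / V)
  refine ⟨1 + K / r + 2 * B - 1 / 2 * Real.log v, N + 1, fun n hn => ?_⟩
  obtain ⟨m, rfl⟩ : ∃ m, n = m + 1 := ⟨n - 1, by omega⟩
  have hn0 : (0 : ℝ) < ((m + 1 : ℕ) : ℝ) := by positivity
  have hnV : 0 < ((m + 1 : ℕ) : ℝ) * V := mul_pos hn0 hVpos
  set σ := √(((m + 1 : ℕ) : ℝ) * V) with hσ_def
  have hσ : 0 < σ := Real.sqrt_pos.2 hnV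
  have hσK : K / r ≤ σ := by
    refine Real.le_sqrt_of_sq_le ?_
    have h1 : (K / r) ^ 2 ≤ N * V := (div_le_iff₀ hVpos).1 hN
    have h2 : (N : ℝ) ≤ ((m + 1 : ℕ) : ℝ) := by exact_mod_cast (by omega : N ≤ m + 1)
    exact h1.trans (by gcongr)
  set a := σ * t - (1 + K / r) with ha
  have hτ : ∀ s : ℝ, (1 / ((m + 1 : ℕ) : ℝ)) * (s + ((m + 1 : ℕ) : ℝ) * E) ≤
      E + a / ((m + 1 : ℕ) : ℝ) ↔ s ≤ a := fun s => by
    have e : (1 / ((m + 1 : ℕ) : ℝ)) * (s + ((m + 1 : ℕ) : ℝ) * E) =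
        E + s / ((m + 1 : ℕ) : ℝ) := by field_simp; ring
    rw [e, add_le_add_iff_left, div_le_div_iff_of_pos_right hn0]
  refine ⟨E + a / ((m + 1 : ℕ) : ℝ), ?_⟩
  have hPle := prodProb_setOf_sum P j E (m + 1)
    (fun s => (1 / ((m + 1 : ℕ) : ℝ)) * s ≤ E + a / ((m + 1 : ℕ) : ℝ))
  have hPgt := prodProb_setOf_sum P j E (m + 1)
    (fun s => (1 / ((m + 1 : ℕ) : ℝ)) * s > E + a / ((m + 1 : ℕ) : ℝ))
  have hQgt := prodProb_setOf_sum Q j E (m + 1)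
    (fun s => (1 / ((m + 1 : ℕ) : ℝ)) * s > E + a / ((m + 1 : ℕ) : ℝ))
  simp only [gt_iff_lt, ← not_le, hτ] at hPle hPgt hQgt ⊢
  have hType1 : iidExp P g (m + 1) (fun s => if s ≤ a then 1 else 0) ≤ ε := by
    have hσ' : σ⁻¹ = (√(((m : ℝ) + 1) * ∑ z, P z * g z ^ 2))⁻¹ := by
      rw [hσ_def, hV]; push_cast; rfl
    have hbe := iidExp_indicator_Iic_le (fun z => (hP.1 z).le) hP.2 hgP hB0 hB
      (by rwa [hV] at hVpos) hσ' (σ⁻¹ * a)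
    simp only [mul_le_mul_iff_right₀ (inv_pos.2 hσ)] at hbe
    have e : σ⁻¹ * a + σ⁻¹ = t - K / r * σ⁻¹ := by rw [ha]; field_simp; ring
    have hcdf := stdNormalCDF_sub_le t (d := K / r * σ⁻¹) (by positivity)
      (by rwa [← div_eq_mul_inv, div_le_one hσ])
    rw [stdNormalCDF_stdNormalCDFInv hε0 hε1, ← hr_def] at hcdf
    have e2 : r * (K / r * σ⁻¹) = K * σ⁻¹ := by field_simp
    rw [e, ← hK] at hbe
    linarith
  rw [hPle]
  refine ⟨hType1, ?_⟩
  have hcompl : iidExp P g (m + 1) (fun s => if s ≤ a then 1 else 0) +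
      iidExp P g (m + 1) (fun s => if ¬ s ≤ a then 1 else 0) = 1 := by
    rw [← iidExp_add]
    refine Eq.trans ?_ (iidExp_const (g := g) hP.2 (m + 1) 1)
    congr 1
    funext s
    by_cases h : s ≤ a <;> simp [h]
  have hPgt0 : iidExp P g (m + 1) (fun s => if ¬ s ≤ a then 1 else 0) ≠ 0 := by linarith
  have hQpos := prodProb_pos_of_ne_zero hQ.1 (hPgt.trans_ne hPgt0)
  have htilt : ∀ z, Q z = Ps z * Real.exp (-(g z + E)) := fun z => by
    simp only [hg_def, sub_add_cancel]
    rw [hj, ← Real.log_inv, Real.exp_log (inv_pos.2 (div_pos (hPs0 z) (hQ.1 z))), inv_div,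
      mul_div_cancel₀ _ (hPs0 z).ne']
  have hvn : 0 < (((m + 1 : ℕ) : ℝ) + 1) * v := by positivity
  have hType2 : prodProb Q (m + 1)
      {z | ¬ 1 / ((m + 1 : ℕ) : ℝ) * ∑ i, j (z.1 i, z.2 i) ≤ E + a / ((m + 1 : ℕ) : ℝ)} ≤
      Real.exp (-(((m + 1 : ℕ) : ℝ) * E)) *
        (Real.exp (2 * B - a) / √((((m + 1 : ℕ) : ℝ) + 1) * v)) := by
    have e : (fun s : ℝ => Real.exp (-(s + ((m + 1 : ℕ) : ℝ) * E)) * if ¬ s ≤ a then 1 else 0) =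
        fun s => Real.exp (-(((m + 1 : ℕ) : ℝ) * E)) * if a < s then Real.exp (-s) else 0 := by
      funext s
      by_cases h : s ≤ a
      · simp [h]
      · rw [if_pos h, if_pos (not_le.1 h), mul_one, ← Real.exp_add]
        ring_nf
    rw [hQgt, iidExp_exp_tilt htilt, e, iidExp_const_mul]
    exact mul_le_mul_of_nonneg_left
      (iidExp_exp_neg_tail_le hPs.1 hPs.2 hgPs hB0 hB hv a (m + 1)) (Real.exp_pos _).le
  have hlog := Real.log_le_log hQpos hType2
  rw [Real.log_mul (Real.exp_pos _).ne' (by positivity), Real.log_exp,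
    Real.log_div (Real.exp_pos _).ne' (by positivity), Real.log_exp, Real.log_sqrt hvn.le,
    Real.log_mul (by positivity) hv.ne'] at hlog
  have hmono : Real.log ((m + 1 : ℕ) : ℝ) ≤ Real.log (((m + 1 : ℕ) : ℝ) + 1) :=
    Real.log_le_log hn0 (by linarith)
  linarith
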